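/- Let 1 < p < ∞ with conjugate index q, let ω be an almost monotone algebra weight on ℤ, let A be a unital Banach algebra, and let f : 𝕋 → A be continuous with pω-ACFS. If f(z) is left invertible in A for every z ∈ 𝕋, then there exist an almost monotone algebra weight ν on ℤ and a continuous function g : 𝕋 → A such that: (1) there is K > 0 with 1 ≤ ν(n) ≤ K ω(n) for all n ∈ ℤ; (2) g has pν-ACFS; (3) g(z)·f(z) equals the unit of A for all z ∈ 𝕋. In particular, if ω is admissible, then f has a left inverse with pω-ACFS. -/

import Mathlib

open scoped BigOperators

/-- A weight on `ℤ`: `ω : ℤ → [1,∞)` with `ω(m+n) ≤ ω(m)ω(n)`. -/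
def IsWeight (ω : ℤ → ℝ) : Prop :=
  (∀ n, 1 ≤ ω n) ∧ ∀ m n, ω (m + n) ≤ ω m * ω n

/-- `ρ₁(ω) = sup{ω(-n)^{-1/n} : n ∈ ℕ, n ≥ 1}`. -/
noncomputable def rho1 (ω : ℤ → ℝ) : ℝ :=
  sSup {x : ℝ | ∃ n : ℕ, 0 < n ∧ x = ω (-(n : ℤ)) ^ (-(1 : ℝ) / (n : ℝ))}

/-- `ρ₂(ω) = inf{ω(n)^{1/n} : n ∈ ℕ, n ≥ 1}`. -/
noncomputable def rho2 (ω : ℤ → ℝ) : ℝ :=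
  sInf {x : ℝ | ∃ n : ℕ, 0 < n ∧ x = ω (n : ℤ) ^ ((1 : ℝ) / (n : ℝ))}

/-- A weight is admissible if `ρ₁(ω) = ρ₂(ω) = 1`. -/
def IsAdmissible (ω : ℤ → ℝ) : Prop := rho1 ω = 1 ∧ rho2 ω = 1

/-- An almost monotone algebra weight on `ℤ` (for conjugate index `q`):
`ω^{-q} ⋆ ω^{-q} ≤ ω^{-q}`, `∑ ω(n)^{-q} < ∞`, and the almost monotonicity conditions
when `ρ₁(ω) = 1` resp. `ρ₂(ω) = 1`. -/
def IsAMAW (q : ℝ) (ω : ℤ → ℝ) : Prop :=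
  IsWeight ω ∧
  (∀ n : ℤ, (∑' k : ℤ, ω k ^ (-q) * ω (n - k) ^ (-q)) ≤ ω n ^ (-q)) ∧
  (Summable fun n : ℤ => ω n ^ (-q)) ∧
  (rho1 ω = 1 → ∃ K > (0 : ℝ), ∀ n k : ℤ, n ≤ -1 → k ≤ -1 → ω n ≤ K * ω (n + k)) ∧
  (rho2 ω = 1 → ∃ K > (0 : ℝ), ∀ n k : ℤ, 0 ≤ n → 0 ≤ k → ω n ≤ K * ω (n + k))

/-- The `n`-th Fourier coefficient of `f : 𝕋 → A`. -/
noncomputable def fourierCoef {A : Type*} [NormedRing A] [NormedAlgebra ℂ A]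
    (f : ℂ → A) (n : ℤ) : A :=
  ((2 * Real.pi : ℝ) : ℂ)⁻¹ • ∫ t in (0 : ℝ)..(2 * Real.pi),
    Complex.exp (-(n : ℂ) * Complex.I * (t : ℂ)) • f (Complex.exp (Complex.I * (t : ℂ)))

/-- `f` has `p`-th power `ω`-absolutely convergent Fourier series. -/
def HasPACFS {A : Type*} [NormedRing A] [NormedAlgebra ℂ A] [CompleteSpace A]
    (p : ℝ) (ω : ℤ → ℝ) (f : ℂ → A) : Prop :=
  (∀ z : ℂ, ‖z‖ = 1 → HasSum (fun n : ℤ => z ^ n • fourierCoef f n) (f z)) ∧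
  Summable fun n : ℤ => ‖fourierCoef f n‖ ^ p * ω n ^ p


theorem conv_sum {R : Type*} [NormedRing R] [CompleteSpace R] (f g : ℤ → R)
    (hf : Summable fun n => ‖f n‖) (hg : Summable fun n => ‖g n‖) :
    (∀ n, Summable fun k => f k * g (n - k)) ∧ (Summable fun n => ∑' k, f k * g (n - k)) ∧
    ∑' n, ∑' k, f k * g (n - k) = (∑' n, f n) * ∑' n, g n := by
  let e : ℤ × ℤ ≃ ℤ × ℤ :=
    { toFun := fun x => (x.2, x.1 - x.2)
      invFun := fun x => (x.1 + x.2, x.1)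
      left_inv := fun x => by simp
      right_inv := fun x => by simp }
  have h := summable_mul_of_summable_norm hf hg
  have h2 : Summable fun x : ℤ × ℤ => f x.2 * g (x.1 - x.2) := (e.summable_iff).2 h
  refine ⟨fun n => h2.prod_factor n, h2.prod, ?_⟩
  rw [tsum_mul_tsum_of_summable_norm hf hg, ← h2.tsum_prod]
  exact e.tsum_eq (fun x : ℤ × ℤ => f x.1 * g x.2)

theorem fourierCoef_series {A : Type*} [NormedRing A] [NormedAlgebra ℂ A] [CompleteSpace A]
    (a : ℤ → A) (ha : Summable fun n => ‖a n‖) (g : ℂ → A)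
    (hg : ∀ z : ℂ, ‖z‖ = 1 → g z = ∑' n, z ^ n • a n) (n : ℤ) : fourierCoef g n = a n := by
  have hz : ∀ t : ℝ, ‖Complex.exp (Complex.I * (t : ℂ))‖ = 1 := fun t => by
    rw [mul_comm]; exact Complex.norm_exp_ofReal_mul_I t
  have hterm : ∀ (t : ℝ) (k : ℤ), Complex.exp (-(n : ℂ) * Complex.I * (t : ℂ)) •
      (Complex.exp (Complex.I * (t : ℂ)) ^ k • a k)
      = Complex.exp (((k - n : ℤ) : ℂ) * Complex.I * (t : ℂ)) • a k := by
    intro t k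
    rw [smul_smul, ← Complex.exp_int_mul, ← Complex.exp_add]
    congr 2
    push_cast
    ring
  have hnorm : ∀ (m : ℤ) (t : ℝ), ‖Complex.exp ((m : ℂ) * Complex.I * (t : ℂ))‖ = 1 := by
    intro m t
    have : (m : ℂ) * Complex.I * (t : ℂ) = ((m * t : ℝ) : ℂ) * Complex.I := by push_cast; ring
    rw [this]
    exact Complex.norm_exp_ofReal_mul_I _
  have hsum : ∀ t : ℝ, HasSum (fun k : ℤ => Complex.exp (((k - n : ℤ) : ℂ) * Complex.I * (t : ℂ)) • a k)
      (Complex.exp (-(n : ℂ) * Complex.I * (t : ℂ)) • g (Complex.exp (Complex.I * (t : ℂ)))) := by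
    intro t
    rw [hg _ (hz t)]
    have : Summable fun k : ℤ => Complex.exp (Complex.I * (t : ℂ)) ^ k • a k := by
      apply Summable.of_norm
      simpa [norm_smul, norm_zpow, hz t] using ha
    have h2 := this.hasSum.const_smul (Complex.exp (-(n : ℂ) * Complex.I * (t : ℂ)))
    simpa only [hterm] using h2
  have hI := intervalIntegral.hasSum_integral_of_dominated_convergence (μ := MeasureTheory.volume)
    (a := 0) (b := 2 * Real.pi)
    (F := fun (k : ℤ) (t : ℝ) => Complex.exp (((k - n : ℤ) : ℂ) * Complex.I * (t : ℂ)) • a k)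
    (f := fun t : ℝ => Complex.exp (-(n : ℂ) * Complex.I * (t : ℂ)) • g (Complex.exp (Complex.I * (t : ℂ))))
    (fun k _ => ‖a k‖)
    (fun k => (by fun_prop : Continuous _).aestronglyMeasurable)
    (fun k => Filter.Eventually.of_forall fun t _ => by rw [norm_smul, hnorm, one_mul])
    (Filter.Eventually.of_forall fun t _ => ha)
    (by simp)
    (Filter.Eventually.of_forall fun t _ => hsum t)
  have hk : ∀ k : ℤ, ∫ t in (0:ℝ)..(2 * Real.pi), Complex.exp (((k - n : ℤ) : ℂ) * Complex.I * (t : ℂ)) • a k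
      = if k = n then ((2 * Real.pi : ℝ) : ℂ) • a n else 0 := by
    intro k
    rw [intervalIntegral.integral_smul_const]
    split_ifs with h
    · subst h
      simp
    · have hne : ((k - n : ℤ) : ℂ) * Complex.I ≠ 0 := by
        apply mul_ne_zero _ Complex.I_ne_zero
        exact_mod_cast sub_ne_zero.2 h
      rw [integral_exp_mul_complex hne]
      have : ((k - n : ℤ) : ℂ) * Complex.I * ((2 * Real.pi : ℝ) : ℂ)
          = ((k - n : ℤ) : ℂ) * (2 * Real.pi * Complex.I) := by push_cast; ring
      rw [this, Complex.exp_int_mul_two_pi_mul_I]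
      simp
  simp only [hk] at hI
  have h3 := hI.unique (hasSum_ite_eq n _)
  rw [fourierCoef, h3, smul_smul, inv_mul_cancel₀, one_smul]
  exact_mod_cast (by positivity : (2 * Real.pi : ℝ) ≠ 0)

structure WGood (p q : ℝ) (ν : ℤ → ℝ) : Prop where
  hpq : p.HolderConjugate q
  one_le : ∀ n, 1 ≤ ν n
  conv : ∀ n : ℤ, (∑' k : ℤ, ν k ^ (-q) * ν (n - k) ^ (-q)) ≤ ν n ^ (-q)
  summ : Summable fun n : ℤ => ν n ^ (-q)

theorem WGood.pos {p q : ℝ} {ν : ℤ → ℝ} (h : WGood p q ν) (n : ℤ) : 0 < ν n :=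
  lt_of_lt_of_le one_pos (h.one_le n)

theorem WGood.summ_inv {p q : ℝ} {ν : ℤ → ℝ} (h : WGood p q ν) (x : ℤ → ℝ) (hx : ∀ n, 0 ≤ x n)
    (hs : Summable fun n => x n ^ p) : Summable fun n => (ν n)⁻¹ * x n := by
  have h2 : Summable fun n : ℤ => ((ν n)⁻¹) ^ q := by
    refine h.summ.congr fun n => ?_
    rw [Real.rpow_neg (h.pos n).le, Real.inv_rpow (h.pos n).le]
  exact Real.summable_mul_of_Lp_Lq_of_nonneg h.hpq.symm
    (fun n => (inv_pos.2 (h.pos n)).le) hx h2 hs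

theorem WGood.bound {p q : ℝ} {ν : ℤ → ℝ} (h : WGood p q ν) (x y : ℤ → ℝ) (hx : ∀ n, 0 ≤ x n)
    (hy : ∀ n, 0 ≤ y n)
    (hxs : Summable fun n => x n ^ p) (hys : Summable fun n => y n ^ p) (n : ℤ) :
    (ν n * ∑' k, ((ν k)⁻¹ * x k) * ((ν (n - k))⁻¹ * y (n - k))) ^ p
      ≤ ∑' k, x k ^ p * y (n - k) ^ p := by
  have hnn : ∀ (z : ℤ → ℝ) (r : ℝ), (∀ n, 0 ≤ z n) → (Summable fun n => z n ^ r) →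
      Summable fun n => ‖z n ^ r‖ := by
    intro z r hz hs
    exact hs.norm
  have c1 := (conv_sum _ _ (hnn x p hx hxs) (hnn y p hy hys)).1 n
  have c2 := (conv_sum _ _ (hnn ν (-q) (fun n => (h.pos n).le) h.summ)
    (hnn ν (-q) (fun n => (h.pos n).le) h.summ)).1 n
  have hi : ∀ n, 0 ≤ (ν n)⁻¹ := fun n => (inv_pos.2 (h.pos n)).le
  have e1 : ∀ k, (x k * y (n - k)) ^ p = x k ^ p * y (n - k) ^ p := fun k =>
    Real.mul_rpow (hx _) (hy _)
  have e2 : ∀ k, ((ν k)⁻¹ * (ν (n - k))⁻¹) ^ q = ν k ^ (-q) * ν (n - k) ^ (-q) := fun k => by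
    rw [Real.mul_rpow (hi _) (hi _), Real.rpow_neg (h.pos _).le, Real.inv_rpow (h.pos _).le,
      Real.rpow_neg (h.pos _).le, Real.inv_rpow (h.pos _).le]
  have H := Real.inner_le_Lp_mul_Lq_tsum_of_nonneg h.hpq
    (f := fun k => x k * y (n - k)) (g := fun k => (ν k)⁻¹ * (ν (n - k))⁻¹)
    (fun k => mul_nonneg (hx _) (hy _)) (fun k => mul_nonneg (hi _) (hi _))
    (by simpa only [e1] using c1) (by simpa only [e2] using c2)
  simp only [e1, e2] at H
  have hc := h.conv n
  have hp0 := h.hpq.pos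
  have hq0 := h.hpq.symm.pos
  have hX : 0 ≤ ∑' k, x k ^ p * y (n - k) ^ p := tsum_nonneg fun k =>
    mul_nonneg (Real.rpow_nonneg (hx _) _) (Real.rpow_nonneg (hy _) _)
  have hY : 0 ≤ ∑' k, ν k ^ (-q) * ν (n - k) ^ (-q) := tsum_nonneg fun k =>
    mul_nonneg (Real.rpow_nonneg (h.pos _).le _) (Real.rpow_nonneg (h.pos _).le _)
  have h4 : (∑' k, ν k ^ (-q) * ν (n - k) ^ (-q)) ^ (1 / q) ≤ (ν n)⁻¹ := by
    calc _ ≤ (ν n ^ (-q)) ^ (1 / q) := Real.rpow_le_rpow hY hc (by positivity)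
      _ = (ν n)⁻¹ := by
        rw [← Real.rpow_mul (h.pos n).le]
        have : -q * (1 / q) = -1 := by field_simp
        rw [this, Real.rpow_neg_one]
  have h5 : ν n * ∑' k, ((ν k)⁻¹ * x k) * ((ν (n - k))⁻¹ * y (n - k))
      ≤ (∑' k, x k ^ p * y (n - k) ^ p) ^ (1 / p) := by
    have : ∀ k, ((ν k)⁻¹ * x k) * ((ν (n - k))⁻¹ * y (n - k))
      = x k * y (n - k) * ((ν k)⁻¹ * (ν (n - k))⁻¹) := fun k => by ring
    simp only [this]
    calc _ ≤ ν n * ((∑' k, x k ^ p * y (n - k) ^ p) ^ (1 / p) * (ν n)⁻¹) := by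
          apply mul_le_mul_of_nonneg_left _ (h.pos n).le
          exact H.trans (mul_le_mul_of_nonneg_left h4 (Real.rpow_nonneg hX _))
      _ = _ := by
          have := (h.pos n).ne'
          field_simp
  calc _ ≤ ((∑' k, x k ^ p * y (n - k) ^ p) ^ (1 / p)) ^ p := by
        apply Real.rpow_le_rpow _ h5 hp0.le
        exact mul_nonneg (h.pos n).le (tsum_nonneg fun k =>
          mul_nonneg (mul_nonneg (hi _) (hx _)) (mul_nonneg (hi _) (hy _)))
    _ = _ := by
        rw [← Real.rpow_mul hX, one_div_mul_cancel hp0.ne', Real.rpow_one]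

theorem allan_aux {B : Type*} [NormedRing B] [NormedAlgebra ℂ B] [CompleteSpace B]
    (S f : B) (hS : ∀ b, b * S = S * b) (hf : ¬ ∃ y, y * f = 1) :
    ∃ L : Ideal B, L ≠ ⊤ ∧ IsClosed (L : Set B) ∧ f ∈ L ∧ ∃ l : ℂ, S - algebraMap ℂ B l ∈ L := by
  have h1 : Ideal.span {f} ≠ ⊤ := by
    intro h
    rw [Ideal.eq_top_iff_one, Ideal.mem_span_singleton'] at h
    exact hf h
  obtain ⟨L, hL, hle⟩ := Ideal.exists_le_maximal _ h1
  have hfL : f ∈ L := hle (Ideal.subset_span rfl)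
  have hcl : IsClosed (L : Set B) := by
    have h2 := Ideal.closure_ne_top L hL.ne_top
    have h3 : L.closure = L := (hL.eq_of_le h2 subset_closure).symm
    rw [← h3]
    exact isClosed_closure
  refine ⟨L, hL.ne_top, hcl, hfL, ?_⟩
  by_contra hcon
  push Not at hcon
  set M : Submodule ℂ B := L.restrictScalars ℂ with hM
  have hMcl : IsClosed (M : Set B) := hcl
  have : IsClosed (M : Set B) := hMcl
  have hmem : ∀ b, b ∈ M ↔ b ∈ L := fun b => Iff.rfl
  have : Nontrivial (B ⧸ M) := by
    apply Submodule.Quotient.nontrivial_iff.2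
    intro h
    apply hL.ne_top
    rw [Ideal.eq_top_iff_one, ← hmem, h]
    trivial
  let T0 : (B ⧸ M) →ₗ[ℂ] (B ⧸ M) := M.mapQ M (LinearMap.mulLeft ℂ S) (fun b hb => by
    exact L.mul_mem_left S hb)
  let T : (B ⧸ M) →L[ℂ] (B ⧸ M) := ⟨T0, by
    have hq : Topology.IsQuotientMap (M.mkQ : B → B ⧸ M) := isQuotientMap_quot_mk
    refine hq.continuous_iff.2 ?_
    have : (T0 ∘ M.mkQ : B → B ⧸ M) = M.mkQ ∘ (fun b => S * b) := by
      ext b; rfl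
    change Continuous (T0 ∘ M.mkQ)
    rw [this]
    exact hq.continuous.comp (continuous_const.mul continuous_id)⟩
  obtain ⟨l, hl⟩ := spectrum.nonempty T
  apply hl
  have hlL := hcon l
  have hv : ∀ b : B, (algebraMap ℂ ((B ⧸ M) →L[ℂ] (B ⧸ M)) l - T) (M.mkQ b)
      = M.mkQ (-((S - algebraMap ℂ B l) * b)) := by
    intro b
    have : T (M.mkQ b) = M.mkQ (S * b) := rfl
    rw [sub_apply, this, Algebra.algebraMap_eq_smul_one,
      Algebra.algebraMap_eq_smul_one]
    simp only [sub_mul, neg_sub, map_sub, smul_mul_assoc, one_mul, map_smul]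
    rfl
  have hcomm : ∀ b : B, b * (S - algebraMap ℂ B l) = (S - algebraMap ℂ B l) * b := by
    intro b
    rw [mul_sub, sub_mul, hS, Algebra.commutes]
  rw [spectrum.mem_resolventSet_iff, ContinuousLinearMap.isUnit_iff_bijective]
  constructor
  · rw [injective_iff_map_eq_zero]
    intro x
    obtain ⟨b, rfl⟩ := M.mkQ_surjective x
    rw [hv]
    intro h0
    rw [Submodule.mkQ_apply, Submodule.Quotient.mk_eq_zero] at h0 ⊢
    rw [hmem] at h0 ⊢
    rw [neg_mem_iff] at h0
    let J : Ideal B := Submodule.comap (LinearMap.toSpanSingleton B B (S - algebraMap ℂ B l)) L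
    have hJ : ∀ c, c ∈ J ↔ c * (S - algebraMap ℂ B l) ∈ L := fun c => by
      simp [J]
    have hJt : J ≠ ⊤ := by
      rw [Ne, Ideal.eq_top_iff_one, hJ, one_mul]
      exact hlL
    have : L = J := hL.eq_of_le hJt (fun c hc => by
      rw [hJ, hcomm]
      exact L.mul_mem_left _ hc)
    rw [this, hJ, hcomm]
    exact h0
  · intro x
    obtain ⟨b, rfl⟩ := M.mkQ_surjective x
    have h5 : L ⊔ Ideal.span {S - algebraMap ℂ B l} = ⊤ := by
      apply hL.1.2
      refine lt_of_le_of_ne le_sup_left ?_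
      intro h
      apply hlL
      rw [h]
      exact Submodule.mem_sup_right (Ideal.subset_span rfl)
    rw [Ideal.eq_top_iff_one, Submodule.mem_sup] at h5
    obtain ⟨y, hy, w, hw, hyw⟩ := h5
    rw [Ideal.mem_span_singleton'] at hw
    obtain ⟨c, rfl⟩ := hw
    refine ⟨M.mkQ (-(b * c)), ?_⟩
    rw [hv, ← sub_eq_zero, ← map_sub, Submodule.mkQ_apply, Submodule.Quotient.mk_eq_zero, hmem]
    have : -((S - algebraMap ℂ B l) * -(b * c)) - b = - (b * y) := by
      rw [← hcomm]
      have : b = b * (y + c * (S - algebraMap ℂ B l)) := by rw [hyw, mul_one]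
      rw [neg_mul, neg_neg]
      nth_rewrite 2 [this]
      noncomm_ring
    rw [this, neg_mem_iff]
    exact L.mul_mem_left _ hy


set_option linter.unusedSectionVars false

section WBsec

variable (A : Type*) [NormedRing A] [NormedAlgebra ℂ A] (p q : ℝ) (ν : ℤ → ℝ)

/-- The weighted space `ℓ^p(ℤ, ν; A)`, realised as `lp` via rescaling of coordinates. -/
def WB [Fact (WGood p q ν)] : Type _ := lp (fun _ : ℤ => A) (ENNReal.ofReal p)

variable {A p q ν} [hW : Fact (WGood p q ν)]

theorem WB.fact (p q : ℝ) (ν : ℤ → ℝ) [hW : Fact (WGood p q ν)] : Fact (1 ≤ ENNReal.ofReal p) :=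
  ⟨by rw [ENNReal.one_le_ofReal]; exact hW.out.hpq.lt.le⟩

theorem WB.toReal (p q : ℝ) (ν : ℤ → ℝ) [hW : Fact (WGood p q ν)] : (ENNReal.ofReal p).toReal = p :=
  ENNReal.toReal_ofReal hW.out.hpq.pos.le

noncomputable instance : NormedAddCommGroup (WB A p q ν) :=
  haveI := WB.fact p q ν
  inferInstanceAs (NormedAddCommGroup (lp (fun _ : ℤ => A) (ENNReal.ofReal p)))

noncomputable instance : NormedSpace ℂ (WB A p q ν) :=
  haveI := WB.fact p q ν
  inferInstanceAs (NormedSpace ℂ (lp (fun _ : ℤ => A) (ENNReal.ofReal p)))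

instance [CompleteSpace A] : CompleteSpace (WB A p q ν) :=
  haveI := WB.fact p q ν
  inferInstanceAs (CompleteSpace (lp (fun _ : ℤ => A) (ENNReal.ofReal p)))

namespace WB

/-- underlying scaled sequence -/
def raw (x : WB A p q ν) : ℤ → A := fun n => (show lp (fun _ : ℤ => A) (ENNReal.ofReal p) from x) n

/-- Fourier coefficients -/
noncomputable def coef (x : WB A p q ν) (n : ℤ) : A := ((ν n : ℂ))⁻¹ • raw x n

theorem nu_ne (p q : ℝ) {ν : ℤ → ℝ} [hW : Fact (WGood p q ν)] (n : ℤ) : (ν n : ℂ) ≠ 0 := by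
  have := hW.out.pos n
  exact_mod_cast this.ne'

theorem raw_eq (x : WB A p q ν) (n : ℤ) : raw x n = (ν n : ℂ) • coef x n := by
  rw [coef, smul_smul, mul_inv_cancel₀ (nu_ne p q n), one_smul]

theorem norm_nu (p q : ℝ) {ν : ℤ → ℝ} [hW : Fact (WGood p q ν)] (n : ℤ) : ‖(ν n : ℂ)‖ = ν n := by
  rw [Complex.norm_real, Real.norm_of_nonneg (hW.out.pos n).le]

theorem ext {x y : WB A p q ν} (h : ∀ n, coef x n = coef y n) : x = y := by
  apply lp.ext
  funext n
  change raw x n = raw y n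
  rw [raw_eq, raw_eq, h]

theorem raw_add (x y : WB A p q ν) (n : ℤ) : raw (x + y) n = raw x n + raw y n := rfl
theorem raw_smul (c : ℂ) (y : WB A p q ν) (n : ℤ) : raw (c • y) n = c • raw y n := rfl
theorem raw_zero (n : ℤ) : raw (0 : WB A p q ν) n = 0 := rfl

theorem coef_add (x y : WB A p q ν) (n : ℤ) : coef (x + y) n = coef x n + coef y n := by
  rw [coef, raw_add, smul_add]; rfl
theorem coef_smul (c : ℂ) (y : WB A p q ν) (n : ℤ) : coef (c • y) n = c • coef y n := by
  rw [coef, raw_smul, smul_comm]; rfl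
theorem coef_zero (n : ℤ) : coef (0 : WB A p q ν) n = 0 := by
  rw [coef, raw_zero, smul_zero]

theorem norm_raw (x : WB A p q ν) (n : ℤ) : ‖raw x n‖ = ν n * ‖coef x n‖ := by
  rw [raw_eq, norm_smul, norm_nu p q]

theorem norm_coef (x : WB A p q ν) (n : ℤ) : ‖coef x n‖ = (ν n)⁻¹ * ‖raw x n‖ := by
  rw [coef, norm_smul, norm_inv, norm_nu p q]

theorem hasSum_norm (x : WB A p q ν) : HasSum (fun n => ‖raw x n‖ ^ p) (‖x‖ ^ p) := by
  have := WB.fact p q ν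
  have h := lp.hasSum_norm (E := fun _ : ℤ => A) (p := ENNReal.ofReal p)
    (by rw [WB.toReal p q ν]; exact hW.out.hpq.pos) x
  rw [WB.toReal p q ν] at h
  exact h

theorem summable_coef (x : WB A p q ν) : Summable fun n => ‖coef x n‖ := by
  simp only [norm_coef]
  exact hW.out.summ_inv _ (fun n => norm_nonneg _) (hasSum_norm x).summable

/-- Element with prescribed coefficients. -/
noncomputable def mk (a : ℤ → A) (ha : Summable fun n => (ν n * ‖a n‖) ^ p) : WB A p q ν :=
  (⟨fun n => (ν n : ℂ) • a n, by
    refine memℓp_gen ?_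
    rw [WB.toReal p q ν]
    simpa only [norm_smul, norm_nu p q] using ha⟩ : lp (fun _ : ℤ => A) (ENNReal.ofReal p))

theorem coef_mk (a : ℤ → A) (ha : Summable fun n => (ν n * ‖a n‖) ^ p) (n : ℤ) :
    coef (mk (q := q) a ha) n = a n := by
  change ((ν n : ℂ))⁻¹ • ((ν n : ℂ) • a n) = a n
  rw [smul_smul, inv_mul_cancel₀ (nu_ne p q n), one_smul]

theorem mul_aux1 [CompleteSpace A] (x y : WB A p q ν) :
    Summable fun n => ∑' k, ‖raw x k‖ ^ p * ‖raw y (n - k)‖ ^ p :=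
  (conv_sum _ _ (hasSum_norm x).summable.norm (hasSum_norm y).summable.norm).2.1

theorem mul_aux2 [CompleteSpace A] (x y : WB A p q ν) (n : ℤ) :
    (ν n * ‖∑' k, coef x k * coef y (n - k)‖) ^ p ≤ ∑' k, ‖raw x k‖ ^ p * ‖raw y (n - k)‖ ^ p := by
  refine le_trans ?_ (hW.out.bound _ _ (fun n => norm_nonneg _) (fun n => norm_nonneg _)
    (hasSum_norm x).summable (hasSum_norm y).summable n)
  have h0 := (hW.out.pos n).le
  apply Real.rpow_le_rpow (by positivity) _ hW.out.hpq.pos.le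
  apply mul_le_mul_of_nonneg_left _ h0
  have hs : Summable fun k => ‖coef x k‖ * ‖coef y (n - k)‖ :=
    (conv_sum _ _ (summable_coef x).norm (summable_coef y).norm).1 n
  simp only [← norm_coef]
  apply tsum_of_norm_bounded hs.hasSum
  intro k
  exact norm_mul_le _ _

theorem mul_aux3 [CompleteSpace A] (x y : WB A p q ν) :
    Summable fun n => (ν n * ‖∑' k, coef x k * coef y (n - k)‖) ^ p :=
  Summable.of_nonneg_of_le
    (fun n => Real.rpow_nonneg (mul_nonneg (hW.out.pos n).le (norm_nonneg _)) _) (mul_aux2 x y) (mul_aux1 x y)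

noncomputable instance [CompleteSpace A] : Mul (WB A p q ν) :=
  ⟨fun x y => mk (fun n => ∑' k, coef x k * coef y (n - k)) (mul_aux3 x y)⟩

theorem coef_mul [CompleteSpace A] (x y : WB A p q ν) (n : ℤ) :
    coef (x * y) n = ∑' k, coef x k * coef y (n - k) := coef_mk _ _ n

theorem norm_mul_le' [CompleteSpace A] (x y : WB A p q ν) : ‖x * y‖ ≤ ‖x‖ * ‖y‖ := by
  have hp := hW.out.hpq.pos
  rw [← Real.rpow_le_rpow_iff (norm_nonneg _) (by positivity) hp,
    Real.mul_rpow (norm_nonneg _) (norm_nonneg _), ← (hasSum_norm x).tsum_eq,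
    ← (hasSum_norm y).tsum_eq, ← (hasSum_norm (x * y)).tsum_eq,
    ← (conv_sum _ _ (hasSum_norm x).summable.norm (hasSum_norm y).summable.norm).2.2]
  refine Summable.tsum_le_tsum ?_ (hasSum_norm (x * y)).summable (mul_aux1 x y)
  intro n
  rw [norm_raw, coef_mul]
  exact mul_aux2 x y n

/-- monomial -/
noncomputable def sg (m : ℤ) (a : A) : WB A p q ν :=
  mk (Pi.single m a) (by
    refine summable_of_ne_finset_zero (s := {m}) ?_
    intro n hn
    have : n ≠ m := by simpa using hn
    rw [Pi.single_eq_of_ne this, norm_zero, mul_zero, Real.zero_rpow hW.out.hpq.pos.ne'])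

theorem coef_sg (m : ℤ) (a : A) (n : ℤ) : coef (sg m a : WB A p q ν) n = if n = m then a else 0 := by
  rw [sg, coef_mk, Pi.single_apply]

/-- evaluation -/
noncomputable def ev (x : WB A p q ν) (z : ℂ) : A := ∑' n : ℤ, z ^ n • coef x n

theorem summable_ev_norm (x : WB A p q ν) {z : ℂ} (hz : ‖z‖ = 1) :
    Summable fun n : ℤ => ‖z ^ n • coef x n‖ := by
  simpa [norm_smul, norm_zpow, hz] using summable_coef x

theorem summable_ev [CompleteSpace A] (x : WB A p q ν) {z : ℂ} (hz : ‖z‖ = 1) :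
    Summable fun n : ℤ => z ^ n • coef x n := (summable_ev_norm x hz).of_norm

theorem ev_add [CompleteSpace A] (x y : WB A p q ν) {z : ℂ} (hz : ‖z‖ = 1) :
    ev (x + y) z = ev x z + ev y z := by
  simp only [ev, coef_add, smul_add]
  exact (summable_ev x hz).tsum_add (summable_ev y hz)

theorem ev_smul [CompleteSpace A] (c : ℂ) (y : WB A p q ν) {z : ℂ} (hz : ‖z‖ = 1) :
    ev (c • y) z = c • ev y z := by
  simp only [ev, coef_smul]
  rw [← (summable_ev y hz).tsum_const_smul]
  exact tsum_congr fun n => smul_comm _ _ _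

theorem ev_zero (z : ℂ) : ev (0 : WB A p q ν) z = 0 := by
  simp [ev, coef_zero]

theorem ev_sg (m : ℤ) (a : A) (z : ℂ) : ev (sg m a : WB A p q ν) z = z ^ m • a := by
  simp only [ev, coef_sg, smul_ite, smul_zero]
  rw [tsum_ite_eq m (fun n : ℤ => z ^ n • a)]

theorem ev_mul [CompleteSpace A] (x y : WB A p q ν) {z : ℂ} (hz : ‖z‖ = 1) :
    ev (x * y) z = ev x z * ev y z := by
  have hz0 : z ≠ 0 := by rintro rfl; simp at hz
  simp only [ev, coef_mul]
  rw [← (conv_sum _ _ (summable_ev_norm x hz) (summable_ev_norm y hz)).2.2]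
  refine tsum_congr fun n => ?_
  rw [← ((conv_sum _ _ (summable_coef x) (summable_coef y)).1 n).tsum_const_smul]
  refine tsum_congr fun k => ?_
  rw [smul_mul_smul_comm, ← zpow_add₀ hz0]
  congr 2
  ring

theorem fourierCoef_ev [CompleteSpace A] (x : WB A p q ν) (n : ℤ) : fourierCoef (ev x) n = coef x n :=
  fourierCoef_series _ (summable_coef x) _ (fun _ _ => rfl) n

theorem ev_inj [CompleteSpace A] {x y : WB A p q ν} (h : ∀ z : ℂ, ‖z‖ = 1 → ev x z = ev y z) : x = y := by
  apply ext
  intro n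
  rw [← fourierCoef_ev x]
  exact fourierCoef_series _ (summable_coef y) _ (fun z hz => h z hz) n

noncomputable instance [CompleteSpace A] : NormedRing (WB A p q ν) :=
  { (inferInstance : NormedAddCommGroup (WB A p q ν)) with
    mul := fun x y => x * y
    one := sg 0 1
    left_distrib := fun x y w => ev_inj fun z hz => by
      change ev (x * (y + w)) z = ev (x * y + x * w) z
      rw [ev_add _ _ hz, ev_mul _ _ hz, ev_mul _ _ hz, ev_mul _ _ hz, ev_add _ _ hz, mul_add]
    right_distrib := fun x y w => ev_inj fun z hz => by
      change ev ((x + y) * w) z = ev (x * w + y * w) z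
      rw [ev_add _ _ hz, ev_mul _ _ hz, ev_mul _ _ hz, ev_mul _ _ hz, ev_add _ _ hz, add_mul]
    zero_mul := fun x => ev_inj fun z hz => by
      change ev (0 * x) z = ev (0 : WB A p q ν) z
      rw [ev_mul _ _ hz, ev_zero, zero_mul]
    mul_zero := fun x => ev_inj fun z hz => by
      change ev (x * 0) z = ev (0 : WB A p q ν) z
      rw [ev_mul _ _ hz, ev_zero, mul_zero]
    mul_assoc := fun x y w => ev_inj fun z hz => by
      change ev (x * y * w) z = ev (x * (y * w)) z
      rw [ev_mul _ _ hz, ev_mul _ _ hz, ev_mul _ _ hz, ev_mul _ _ hz, mul_assoc]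
    one_mul := fun x => ev_inj fun z hz => by
      change ev (sg 0 1 * x) z = ev x z
      rw [ev_mul _ _ hz, ev_sg, zpow_zero, one_smul, one_mul]
    mul_one := fun x => ev_inj fun z hz => by
      change ev (x * sg 0 1) z = ev x z
      rw [ev_mul _ _ hz, ev_sg, zpow_zero, one_smul, mul_one]
    norm_mul_le := norm_mul_le' }

theorem one_def [CompleteSpace A] : (1 : WB A p q ν) = sg 0 1 := rfl

noncomputable instance [CompleteSpace A] : NormedAlgebra ℂ (WB A p q ν) :=
  { Algebra.ofModule (R := ℂ) (A := WB A p q ν)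
      (fun c x y => ev_inj fun z hz => by
        rw [ev_smul _ _ hz, ev_mul _ _ hz, ev_mul _ _ hz, ev_smul _ _ hz, smul_mul_assoc])
      (fun c x y => ev_inj fun z hz => by
        rw [ev_smul _ _ hz, ev_mul _ _ hz, ev_mul _ _ hz, ev_smul _ _ hz, mul_smul_comm]) with
    norm_smul_le := fun c x => (norm_smul c x).le }

theorem ev_one [CompleteSpace A] {z : ℂ} : ev (1 : WB A p q ν) z = 1 := by
  rw [one_def, ev_sg, zpow_zero, one_smul]

theorem norm_sg (m : ℤ) (a : A) : ‖(sg m a : WB A p q ν)‖ = ν m * ‖a‖ := by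
  have h := hasSum_norm (sg m a : WB A p q ν)
  have hp := hW.out.hpq.pos
  have h2 : (fun n => ‖raw (sg m a : WB A p q ν) n‖ ^ p)
      = fun n => if n = m then (ν m * ‖a‖) ^ p else 0 := by
    funext n
    rw [norm_raw, coef_sg]
    split_ifs with hn
    · rw [hn]
    · rw [norm_zero, mul_zero, Real.zero_rpow hp.ne']
  rw [h2] at h
  have h3 := h.unique (hasSum_ite_eq m _)
  have h0 := (hW.out.pos m).le
  exact (Real.rpow_left_inj (norm_nonneg _) (by positivity) hp.ne').1 h3

theorem hasSum_sg (x : WB A p q ν) : HasSum (fun n => (sg n (coef x n) : WB A p q ν)) x := by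
  have := WB.fact p q ν
  have h := lp.hasSum_single (E := fun _ : ℤ => A) (p := ENNReal.ofReal p) ENNReal.ofReal_ne_top x
  have e : (fun n => (sg n (coef x n) : WB A p q ν))
      = fun i => (lp.single (E := fun _ : ℤ => A) (ENNReal.ofReal p) i (raw x i)) := by
    funext i
    apply lp.ext
    funext n
    change raw (sg i (coef x i) : WB A p q ν) n = _
    rw [raw_eq, coef_sg, lp.single_apply, Pi.single_apply]
    split_ifs with hn
    · subst hn
      rw [← raw_eq]
    · rw [smul_zero]
  rw [e]
  exact h

/-- constants as a continuous linear map -/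
noncomputable def const : A →L[ℂ] WB A p q ν :=
  LinearMap.mkContinuous
    { toFun := fun a => sg 0 a
      map_add' := fun a b => ext fun n => by
        rw [coef_add, coef_sg, coef_sg, coef_sg]; split_ifs <;> simp
      map_smul' := fun c b => ext fun n => by
        rw [RingHom.id_apply, coef_smul, coef_sg, coef_sg]; split_ifs <;> simp } (ν 0)
    (fun a => (norm_sg 0 a).le)

theorem const_apply (a : A) : const a = (sg 0 a : WB A p q ν) := rfl

theorem sg_mul_sg [CompleteSpace A] (m n : ℤ) (a b : A) :
    (sg m a * sg n b : WB A p q ν) = sg (m + n) (a * b) := ev_inj fun z hz => by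
  have hz0 : z ≠ 0 := by rintro rfl; simp at hz
  rw [ev_mul _ _ hz, ev_sg, ev_sg, ev_sg, smul_mul_smul_comm, zpow_add₀ hz0]

end WB
end WBsec


theorem wiener_aux {A : Type*} [NormedRing A] [NormedAlgebra ℂ A] [CompleteSpace A]
    {p q : ℝ} {ν : ℤ → ℝ} [hW : Fact (WGood p q ν)]
    (g1 : ∀ r : ℝ, 1 < r → ∀ C : ℝ, ∃ n : ℕ, C * ν (n : ℤ) < r ^ n)
    (g2 : ∀ r : ℝ, 1 < r → ∀ C : ℝ, ∃ n : ℕ, C * ν (-(n : ℤ)) < r ^ n)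
    (x : WB A p q ν) (hx : ∀ z : ℂ, ‖z‖ = 1 → ∃ u : A, u * WB.ev x z = 1) :
    ∃ y : WB A p q ν, y * x = 1 := by
  by_contra hcon
  have hS : ∀ b : WB A p q ν, b * WB.sg 1 1 = WB.sg 1 1 * b := fun b => WB.ev_inj fun z hz => by
    rw [WB.ev_mul _ _ hz, WB.ev_mul _ _ hz, WB.ev_sg, mul_smul_comm, smul_mul_assoc, one_mul, mul_one]
  obtain ⟨L, hL, hcl, hxL, l, hl⟩ := allan_aux (WB.sg 1 1 : WB A p q ν) x hS hcon
  have hspec : l ∈ spectrum ℂ (WB.sg 1 1 : WB A p q ν) := by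
    rw [spectrum.mem_iff]
    intro hu
    apply hL
    refine Ideal.eq_top_of_isUnit_mem L ?_ hu
    rw [← neg_sub]
    exact neg_mem hl
  let S : (WB A p q ν)ˣ := ⟨WB.sg 1 1, WB.sg (-1) 1, by rw [WB.sg_mul_sg, WB.one_def]; simp,
    by rw [WB.sg_mul_sg, WB.one_def]; simp⟩
  have hl0 : l ≠ 0 := by
    rintro rfl
    exact spectrum.zero_notMem ℂ S.isUnit hspec
  have hspec2 : l⁻¹ ∈ spectrum ℂ (WB.sg (-1) 1 : WB A p q ν) := by
    exact (spectrum.inv_mem_iff (r := Units.mk0 l hl0) (a := S)).1 hspec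
  have hpow : ∀ (m : ℤ) (n : ℕ), (WB.sg m 1 : WB A p q ν) ^ n = WB.sg (m * n) 1 := by
    intro m n
    induction n with
    | zero => simp [WB.one_def]
    | succ n ih =>
      rw [pow_succ, ih, WB.sg_mul_sg, mul_one]
      congr 1
      push_cast
      ring
  have hb : ∀ (m : ℤ) (k : ℂ), k ∈ spectrum ℂ (WB.sg m 1 : WB A p q ν) → ∀ n : ℕ,
      ‖k‖ ^ n ≤ (‖(1 : A)‖ * ‖(1 : WB A p q ν)‖) * ν (m * n) := by
    intro m k hk n
    have := spectrum.norm_le_norm_mul_of_mem (spectrum.pow_mem_pow _ n hk)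
    rw [hpow, norm_pow, WB.norm_sg] at this
    linarith
  have hl1 : ‖l‖ = 1 := by
    apply le_antisymm
    · by_contra h
      push Not at h
      obtain ⟨n, hn⟩ := g1 _ h (‖(1 : A)‖ * ‖(1 : WB A p q ν)‖)
      have := hb 1 l hspec n
      rw [one_mul] at this
      linarith
    · by_contra h
      push Not at h
      have h' : 1 < ‖l⁻¹‖ := by
        rw [norm_inv]
        exact (one_lt_inv₀ (norm_pos_iff.2 hl0)).2 h
      obtain ⟨n, hn⟩ := g2 _ h' (‖(1 : A)‖ * ‖(1 : WB A p q ν)‖)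
      have := hb (-1) _ hspec2 n
      rw [neg_one_mul] at this
      linarith
  have hsm : ∀ (c : ℂ) (b : WB A p q ν), b ∈ L → c • b ∈ L := fun c b hb => by
    rw [Algebra.smul_def]
    exact L.mul_mem_left _ hb
  have hmon : ∀ n : ℤ, (WB.sg n 1 : WB A p q ν) - algebraMap ℂ _ (l ^ n) ∈ L := by
    intro n
    have hm1 : (WB.sg (-1) 1 : WB A p q ν) - algebraMap ℂ _ l⁻¹ ∈ L := by
      have h3 := hsm (-l⁻¹) _ (L.mul_mem_left (WB.sg (-1) 1) hl)
      convert h3 using 1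
      apply WB.ev_inj
      intro z hz
      have hz0 : z ≠ 0 := by rintro rfl; simp at hz
      simp only [Algebra.algebraMap_eq_smul_one, sub_eq_add_neg, ← neg_smul]
      rw [WB.ev_smul _ _ hz, WB.ev_mul _ _ hz, WB.ev_add _ _ hz, WB.ev_add _ _ hz,
        WB.ev_smul _ _ hz, WB.ev_smul _ _ hz, WB.ev_sg, WB.ev_sg, WB.ev_one]
      simp only [← add_smul, smul_mul_smul_comm, smul_smul, mul_one, zpow_neg_one, zpow_one]
      congr 1
      field_simp
      ring
    induction n using Int.induction_on with
    | zero => simp [← WB.one_def]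
    | succ n ih =>
      have : (WB.sg ((n : ℤ) + 1) 1 : WB A p q ν) - algebraMap ℂ _ (l ^ ((n : ℤ) + 1))
          = WB.sg (n : ℤ) 1 * (WB.sg 1 1 - algebraMap ℂ _ l)
            + algebraMap ℂ _ l * (WB.sg (n : ℤ) 1 - algebraMap ℂ _ (l ^ (n : ℤ))) := by
        rw [zpow_add_one₀ hl0, map_mul, mul_sub, mul_sub, WB.sg_mul_sg, mul_one,
          ← Algebra.commutes l (WB.sg (n : ℤ) 1), ← Algebra.commutes l (algebraMap ℂ (WB A p q ν) (l ^ (n : ℤ)))]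
        abel
      rw [this]
      exact add_mem (L.mul_mem_left _ hl) (L.mul_mem_left _ ih)
    | pred n ih =>
      have : (WB.sg (-(n : ℤ) - 1) 1 : WB A p q ν) - algebraMap ℂ _ (l ^ (-(n : ℤ) - 1))
          = WB.sg (-(n : ℤ)) 1 * (WB.sg (-1) 1 - algebraMap ℂ _ l⁻¹)
            + algebraMap ℂ _ l⁻¹ * (WB.sg (-(n : ℤ)) 1 - algebraMap ℂ _ (l ^ (-(n : ℤ)))) := by
        rw [zpow_sub_one₀ hl0, map_mul, mul_sub, mul_sub, WB.sg_mul_sg, mul_one,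
          ← Algebra.commutes l⁻¹ (WB.sg (-(n : ℤ)) 1), ← Algebra.commutes l⁻¹ (algebraMap ℂ (WB A p q ν) (l ^ (-(n : ℤ)))),
          ← sub_eq_add_neg]
        abel
      rw [this]
      exact add_mem (L.mul_mem_left _ hm1) (L.mul_mem_left _ ih)
  have hmon2 : ∀ (n : ℤ) (a : A), (WB.sg n a : WB A p q ν) - WB.const (l ^ n • a) ∈ L := by
    intro n a
    have h3 := L.mul_mem_left (WB.sg 0 a) (hmon n)
    convert h3 using 1
    rw [mul_sub, WB.sg_mul_sg, zero_add, mul_one, Algebra.algebraMap_eq_smul_one, mul_smul_comm, mul_one,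
      map_smul, WB.const_apply]
  have h1 := WB.hasSum_sg x
  have h2 : HasSum (fun n => (WB.const (l ^ n • WB.coef x n) : WB A p q ν)) (WB.const (WB.ev x l)) :=
    (WB.const (A := A) (p := p) (q := q) (ν := ν)).hasSum (WB.summable_ev x hl1).hasSum
  have h3 := h1.sub h2
  have h4 : x - WB.const (WB.ev x l) ∈ L :=
    hcl.mem_of_tendsto h3 (Filter.Eventually.of_forall fun s => L.sum_mem fun n _ => hmon2 n _)
  have h5 : (WB.const (WB.ev x l) : WB A p q ν) ∈ L := by
    have := sub_mem hxL h4
    rwa [sub_sub_cancel] at this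
  obtain ⟨u, hu⟩ := hx l hl1
  apply hL
  rw [Ideal.eq_top_iff_one]
  have h6 := L.mul_mem_left (WB.sg 0 u) h5
  rw [WB.const_apply, WB.sg_mul_sg, hu, zero_add] at h6
  exact h6

theorem main_aux {A : Type*} [NormedRing A] [NormedAlgebra ℂ A] [CompleteSpace A]
    {p q : ℝ} {ν : ℤ → ℝ} (hW : WGood p q ν)
    (g1 : ∀ r : ℝ, 1 < r → ∀ C : ℝ, ∃ n : ℕ, C * ν (n : ℤ) < r ^ n)
    (g2 : ∀ r : ℝ, 1 < r → ∀ C : ℝ, ∃ n : ℕ, C * ν (-(n : ℤ)) < r ^ n)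
    (f : ℂ → A) (hf : HasPACFS p ν f) (hinv : ∀ z : ℂ, ‖z‖ = 1 → ∃ u : A, u * f z = 1) :
    ∃ g : ℂ → A, ContinuousOn g {z : ℂ | ‖z‖ = 1} ∧ HasPACFS p ν g ∧
      ∀ z : ℂ, ‖z‖ = 1 → g z * f z = 1 := by
  have : Fact (WGood p q ν) := ⟨hW⟩
  have hs : Summable fun n => (ν n * ‖fourierCoef f n‖) ^ p := by
    refine hf.2.congr fun n => ?_
    rw [Real.mul_rpow (hW.pos n).le (norm_nonneg _), mul_comm]
  let x : WB A p q ν := WB.mk _ hs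
  have hxf : ∀ z : ℂ, ‖z‖ = 1 → WB.ev x z = f z := by
    intro z hz
    rw [← (hf.1 z hz).tsum_eq]
    simp only [WB.ev, x, WB.coef_mk]
  obtain ⟨y, hy⟩ := wiener_aux g1 g2 x (fun z hz => by rw [hxf z hz]; exact hinv z hz)
  refine ⟨WB.ev y, ?_, ⟨?_, ?_⟩, ?_⟩
  · apply continuousOn_tsum (u := fun n => ‖WB.coef y n‖) _ (WB.summable_coef y)
    · intro n z hz
      rw [norm_smul, norm_zpow, show ‖z‖ = 1 from hz, one_zpow, one_mul]
    · intro n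
      refine ContinuousOn.smul ?_ continuousOn_const
      intro z hz
      apply (continuousAt_zpow₀ z n _).continuousWithinAt
      left
      rintro rfl
      simp at hz
  · intro z hz
    simp only [WB.fourierCoef_ev]
    exact (WB.summable_ev y hz).hasSum
  · refine (WB.hasSum_norm y).summable.congr fun n => ?_
    rw [WB.fourierCoef_ev, WB.norm_raw, Real.mul_rpow (hW.pos n).le (norm_nonneg _), mul_comm]
  · intro z hz
    rw [← hxf z hz, ← WB.ev_mul _ _ hz, hy, WB.ev_one]


/-- Good one-sided weights. -/
structure HG (q : ℝ) (u : ℕ → ℝ) (K : ℝ) : Prop where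
  zero : u 0 = 1
  one_le : ∀ n, 1 ≤ u n
  sub : ∀ m n, u (m + n) ≤ K * (u m * u n)
  mono : ∀ n k, u n ≤ K * u (n + k)
  summ : Summable fun n => u n ^ (-q)
  conv : ∀ n, ∑ k ∈ Finset.range (n + 1), u k ^ (-q) * u (n - k) ^ (-q) ≤ K * u n ^ (-q)
  growth : ∀ r : ℝ, 1 < r → ∀ C : ℝ, ∃ n : ℕ, C * u n < r ^ n

theorem HG.pos {q K : ℝ} {u : ℕ → ℝ} (h : HG q u K) (n : ℕ) : 0 < u n :=
  lt_of_lt_of_le one_pos (h.one_le n)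

theorem HG.one_le_K {q K : ℝ} {u : ℕ → ℝ} (h : HG q u K) : 1 ≤ K := by
  have := h.mono 0 0
  rw [add_zero, h.zero] at this
  linarith

theorem HG.mono_K {q K K' : ℝ} {u : ℕ → ℝ} (h : HG q u K) (hK : K ≤ K') : HG q u K' where
  zero := h.zero
  one_le := h.one_le
  sub m n := (h.sub m n).trans
    (mul_le_mul_of_nonneg_right hK (mul_nonneg (h.pos m).le (h.pos n).le))
  mono n k := (h.mono n k).trans (mul_le_mul_of_nonneg_right hK (h.pos _).le)
  summ := h.summ
  conv n := (h.conv n).trans (mul_le_mul_of_nonneg_right hK (Real.rpow_nonneg (h.pos _).le _))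
  growth := h.growth

/-- Glue two one-sided weights. -/
def glue (u v : ℕ → ℝ) (n : ℤ) : ℝ := if 0 ≤ n then u n.natAbs else v n.natAbs

theorem glue_nat (u v : ℕ → ℝ) (n : ℕ) : glue u v (n : ℤ) = u n := by
  simp [glue]

theorem glue_neg (u v : ℕ → ℝ) (huv : u 0 = v 0) (n : ℕ) : glue u v (-(n : ℤ)) = v n := by
  rcases Nat.eq_zero_or_pos n with rfl | hn
  · simp [glue, huv]
  · have : ¬ (0 ≤ -(n : ℤ)) := by omega
    rw [glue, if_neg this]
    simp

theorem glue_swap (u v : ℕ → ℝ) (huv : u 0 = v 0) (n : ℤ) : glue u v (-n) = glue v u n := by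
  obtain ⟨m, rfl | rfl⟩ := n.eq_nat_or_neg
  · rw [glue_neg u v huv, glue_nat]
  · rw [neg_neg, glue_nat, glue_neg v u huv.symm]

section glue
variable {q K : ℝ} {u v : ℕ → ℝ}

theorem glue_one_le (hu : HG q u K) (hv : HG q v K) (n : ℤ) : 1 ≤ glue u v n := by
  rw [glue]; split_ifs
  · exact hu.one_le _
  · exact hv.one_le _

theorem glue_summ (hu : HG q u K) (hv : HG q v K) : Summable fun n => glue u v n ^ (-q) := by
  have h0 : u 0 = v 0 := by rw [hu.zero, hv.zero]
  apply Summable.of_nat_of_neg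
  · simpa only [glue_nat] using hu.summ
  · simpa only [glue_neg u v h0] using hv.summ

theorem glue_sub (hu : HG q u K) (hv : HG q v K) (m n : ℤ) :
    glue u v (m + n) ≤ K * (glue u v m * glue u v n) := by
  have h0 : u 0 = v 0 := by rw [hu.zero, hv.zero]
  have hK := hu.one_le_K
  have key : ∀ m n : ℕ, glue u v ((m : ℤ) + -(n : ℤ)) ≤ K * (u m * v n) := by
    intro m n
    rcases le_total n m with h | h
    · obtain ⟨k, rfl⟩ := Nat.exists_eq_add_of_le' h
      have e : ((k + n : ℕ) : ℤ) + -(n : ℤ) = (k : ℤ) := by push_cast; ring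
      rw [e, glue_nat]
      refine (hu.mono k n).trans ?_
      apply mul_le_mul_of_nonneg_left _ (by linarith)
      exact le_mul_of_one_le_right (hu.pos _).le (hv.one_le n)
    · obtain ⟨k, rfl⟩ := Nat.exists_eq_add_of_le' h
      have e : (m : ℤ) + -((k + m : ℕ) : ℤ) = -(k : ℤ) := by push_cast; ring
      rw [e, glue_neg u v h0]
      refine (hv.mono k m).trans ?_
      apply mul_le_mul_of_nonneg_left _ (by linarith)
      exact le_mul_of_one_le_left (hv.pos _).le (hu.one_le m)
  obtain ⟨a, rfl | rfl⟩ := m.eq_nat_or_neg <;> obtain ⟨b, rfl | rfl⟩ := n.eq_nat_or_neg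
  · rw [← Nat.cast_add, glue_nat, glue_nat, glue_nat]
    exact hu.sub a b
  · rw [glue_nat, glue_neg u v h0]
    exact key a b
  · rw [glue_nat, glue_neg u v h0, add_comm, mul_comm (v a)]
    exact key b a
  · rw [← neg_add, ← Nat.cast_add, glue_neg u v h0, glue_neg u v h0, glue_neg u v h0]
    exact hv.sub a b

theorem rpow_neg_le {q K x y : ℝ} (hq : 0 < q) (hx : 0 < x) (hy : 0 < y) (hK : 0 < K)
    (h : x ≤ K * y) : y ^ (-q) ≤ K ^ q * x ^ (-q) := by
  have h1 : (K * y) ^ (-q) ≤ x ^ (-q) := Real.rpow_le_rpow_of_nonpos hx h (by linarith)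
  rw [Real.mul_rpow hK.le hy.le] at h1
  calc y ^ (-q) = K ^ q * (K ^ (-q) * y ^ (-q)) := by
        rw [← mul_assoc, ← Real.rpow_add hK, add_neg_cancel, Real.rpow_zero, one_mul]
    _ ≤ _ := mul_le_mul_of_nonneg_left h1 (Real.rpow_nonneg hK.le _)

theorem glue_conv_nat (hq : 0 < q) (hu : HG q u K) (hv : HG q v K) (n : ℕ) :
    ∑' k : ℤ, glue u v k ^ (-q) * glue u v ((n : ℤ) - k) ^ (-q)
      ≤ (2 * K ^ q * (∑' k, glue u v k ^ (-q)) + K) * glue u v n ^ (-q) := by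
  have hs := glue_summ hu hv
  have hK : 0 < K := lt_of_lt_of_le one_pos hu.one_le_K
  set a : ℤ → ℝ := fun k => glue u v k ^ (-q) with ha
  have hpos : ∀ k, 0 < glue u v k := fun k => lt_of_lt_of_le one_pos (glue_one_le hu hv k)
  have ha0 : ∀ k, 0 ≤ a k := fun k => Real.rpow_nonneg (hpos k).le _
  have hKq : 0 ≤ K ^ q := Real.rpow_nonneg hK.le _
  have hs2 : Summable fun k => a ((n : ℤ) - k) := (Equiv.subLeft (n : ℤ)).summable_iff.2 hs
  have ht2 : ∑' k, a ((n : ℤ) - k) = ∑' k, a k := (Equiv.subLeft (n : ℤ)).tsum_eq a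
  let s : Finset ℤ := (Finset.range (n + 1)).map Nat.castEmbedding
  have hmem : ∀ k : ℤ, k ∈ s ↔ 0 ≤ k ∧ k ≤ n := by
    intro k
    simp only [s, Finset.mem_map, Finset.mem_range, Nat.castEmbedding_apply]
    constructor
    · rintro ⟨j, hj, rfl⟩; omega
    · rintro ⟨h1, h2⟩; exact ⟨k.toNat, by omega, by omega⟩
  let w : ℤ → ℝ := fun k => if k ∈ s then a k * a (n - k) else 0
  have hw : HasSum w (∑ k ∈ s, a k * a (n - k)) := by
    have h1 : ∑ k ∈ s, w k = ∑ k ∈ s, a k * a (n - k) :=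
      Finset.sum_congr rfl fun k hk => if_pos hk
    rw [← h1]
    exact hasSum_sum_of_ne_finset_zero fun k hk => if_neg hk
  have hwle : ∑ k ∈ s, a k * a (n - k) ≤ K * a n := by
    rw [Finset.sum_map]
    refine le_of_eq_of_le ?_ (le_of_le_of_eq (hu.conv n) ?_)
    · apply Finset.sum_congr rfl
      intro k hk
      have hk' : k ≤ n := by rw [Finset.mem_range] at hk; omega
      simp only [Nat.castEmbedding_apply, ha]
      rw [← Nat.cast_sub hk', glue_nat, glue_nat]
    · simp only [ha]; rw [glue_nat]
  have hfar : ∀ j : ℕ, a ((n : ℤ) + j) ≤ K ^ q * a n := by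
    intro j
    simp only [ha]
    apply rpow_neg_le hq (hpos _) (hpos _) hK
    rw [← Nat.cast_add, glue_nat, glue_nat]
    exact hu.mono n j
  have hpt : ∀ k, a k * a (n - k) ≤ K ^ q * a n * (a k + a (n - k)) + w k := by
    intro k
    have hnn : 0 ≤ K ^ q * a n := mul_nonneg hKq (ha0 _)
    by_cases hk : k ∈ s
    · simp only [w, if_pos hk]
      have := mul_nonneg hnn (add_nonneg (ha0 k) (ha0 (n - k)))
      linarith
    · simp only [w, if_neg hk, add_zero, mul_add]
      have h1 := mul_nonneg hnn (ha0 k)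
      have h2 := mul_nonneg hnn (ha0 (n - k))
      rw [hmem, not_and_or] at hk
      rcases hk with hk | hk
      · have h3 := hfar (-k).toNat
        have e : (n : ℤ) + ((-k).toNat : ℤ) = n - k := by omega
        rw [e] at h3
        have := mul_le_mul_of_nonneg_left h3 (ha0 k)
        linarith
      · have h3 := hfar (k - n).toNat
        have e : (n : ℤ) + ((k - n).toNat : ℤ) = k := by omega
        rw [e] at h3
        have := mul_le_mul_of_nonneg_right h3 (ha0 (n - k))
        linarith
  have hsum : HasSum (fun k => K ^ q * a n * (a k + a (n - k)) + w k)
      (K ^ q * a n * (∑' k, a k + ∑' k, a k) + ∑ k ∈ s, a k * a (n - k)) := by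
    refine HasSum.add (HasSum.mul_left _ (hs.hasSum.add ?_)) hw
    rw [← ht2]
    exact hs2.hasSum
  have hterm : Summable fun k => a k * a (n - k) :=
    Summable.of_nonneg_of_le (fun k => mul_nonneg (ha0 _) (ha0 _)) hpt hsum.summable
  have h9 := hterm.tsum_le_tsum hpt hsum.summable
  rw [hsum.tsum_eq] at h9
  refine h9.trans ?_
  have : (2 * K ^ q * (∑' k, a k) + K) * glue u v n ^ (-q)
    = K ^ q * a n * (∑' k, a k + ∑' k, a k) + K * a n := by simp only [ha]; ring
  rw [this]
  linarith

theorem glue_conv (hq : 0 < q) (hu : HG q u K) (hv : HG q v K) (n : ℤ) :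
    ∑' k : ℤ, glue u v k ^ (-q) * glue u v (n - k) ^ (-q)
      ≤ (2 * K ^ q * (∑' k, glue u v k ^ (-q)) + K) * glue u v n ^ (-q) := by
  have h0 : u 0 = v 0 := by rw [hu.zero, hv.zero]
  obtain ⟨m, rfl | rfl⟩ := n.eq_nat_or_neg
  · exact glue_conv_nat hq hu hv m
  · have := glue_conv_nat hq hv hu m
    rw [← (Equiv.neg ℤ).tsum_eq, ← (Equiv.neg ℤ).tsum_eq (fun k => glue u v k ^ (-q))]
    simp only [Equiv.neg_apply]
    have e : ∀ k : ℤ, -(m : ℤ) - -k = -((m : ℤ) - k) := fun k => by ring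
    simp only [e, glue_swap u v h0]
    exact this

end glue

theorem glue_final {p q K : ℝ} {u v : ℕ → ℝ} (hpq : p.HolderConjugate q) (hu : HG q u K) (hv : HG q v K) :
    ∃ c : ℝ, 1 ≤ c ∧ IsAMAW q (fun n => c * glue u v n) := by
  have hq := hpq.symm.pos
  have hK := hu.one_le_K
  have h0 : u 0 = v 0 := by rw [hu.zero, hv.zero]
  have hpos : ∀ k, 0 < glue u v k := fun k => lt_of_lt_of_le one_pos (glue_one_le hu hv k)
  set K' := 2 * K ^ q * (∑' k, glue u v k ^ (-q)) + K with hK'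
  have hK'0 : 0 ≤ K' := by
    have : 0 ≤ ∑' k, glue u v k ^ (-q) := tsum_nonneg fun k => Real.rpow_nonneg (hpos k).le _
    have h2 : 0 ≤ K ^ q := Real.rpow_nonneg (by linarith) _
    positivity
  obtain ⟨c, hc1, hcK, hcK'⟩ : ∃ c : ℝ, 1 ≤ c ∧ K ≤ c ∧ K' ≤ c ^ q := by
    refine ⟨K + K' ^ (1 / q), ?_, ?_, ?_⟩
    · have : 0 ≤ K' ^ (1 / q) := Real.rpow_nonneg hK'0 _
      linarith
    · have : 0 ≤ K' ^ (1 / q) := Real.rpow_nonneg hK'0 _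
      linarith
    · calc K' = (K' ^ (1 / q)) ^ q := by
            rw [← Real.rpow_mul hK'0, one_div_mul_cancel hq.ne', Real.rpow_one]
        _ ≤ _ := Real.rpow_le_rpow (Real.rpow_nonneg hK'0 _) (by linarith) hq.le
  have hc0 : 0 < c := by linarith
  have hmr : ∀ k, (c * glue u v k) ^ (-q) = c ^ (-q) * glue u v k ^ (-q) := fun k =>
    Real.mul_rpow hc0.le (hpos k).le
  refine ⟨c, hc1, ⟨?_, ?_⟩, ?_, ?_, ?_, ?_⟩
  · intro n
    have := glue_one_le hu hv n
    nlinarith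
  · intro m n
    have h1 := glue_sub hu hv m n
    have h2 : K * (glue u v m * glue u v n) ≤ c * (glue u v m * glue u v n) :=
      mul_le_mul_of_nonneg_right hcK (mul_nonneg (hpos _).le (hpos _).le)
    have h3 := mul_le_mul_of_nonneg_left (h1.trans h2) hc0.le
    calc _ ≤ _ := h3
      _ = _ := by ring
  · intro n
    simp only [hmr]
    have e : ∀ k : ℤ, c ^ (-q) * glue u v k ^ (-q) * (c ^ (-q) * glue u v (n - k) ^ (-q))
      = (c ^ (-q) * c ^ (-q)) * (glue u v k ^ (-q) * glue u v (n - k) ^ (-q)) := fun k => by ring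
    simp only [e]
    rw [tsum_mul_left]
    have hcq : 0 ≤ c ^ (-q) := Real.rpow_nonneg hc0.le _
    have h1 : c ^ (-q) * K' ≤ 1 := by
      calc _ ≤ c ^ (-q) * c ^ q := mul_le_mul_of_nonneg_left hcK' hcq
        _ = 1 := by rw [← Real.rpow_add hc0, neg_add_cancel, Real.rpow_zero]
    have h2 := mul_le_mul_of_nonneg_left (glue_conv hq hu hv n) (mul_nonneg hcq hcq)
    refine h2.trans ?_
    have hn : 0 ≤ glue u v n ^ (-q) := Real.rpow_nonneg (hpos n).le _
    calc _ = (c ^ (-q) * glue u v n ^ (-q)) * (c ^ (-q) * K') := by rw [← hK']; ring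
      _ ≤ (c ^ (-q) * glue u v n ^ (-q)) * 1 := mul_le_mul_of_nonneg_left h1 (mul_nonneg hcq hn)
      _ = _ := mul_one _
  · simp only [hmr]
    exact (glue_summ hu hv).mul_left _
  · intro _
    refine ⟨K, by linarith, fun n k hn hk => ?_⟩
    have e1 : n = -((-n).toNat : ℤ) := by omega
    have e2 : k = -((-k).toNat : ℤ) := by omega
    beta_reduce
    rw [e1, e2, ← neg_add, ← Nat.cast_add, glue_neg u v h0, glue_neg u v h0]
    have := mul_le_mul_of_nonneg_left (hv.mono (-n).toNat (-k).toNat) hc0.le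
    linarith
  · intro _
    refine ⟨K, by linarith, fun n k hn hk => ?_⟩
    have e1 : n = (n.toNat : ℤ) := by omega
    have e2 : k = (k.toNat : ℤ) := by omega
    beta_reduce
    rw [e1, e2, ← Nat.cast_add, glue_nat, glue_nat]
    have := mul_le_mul_of_nonneg_left (hu.mono n.toNat k.toNat) hc0.le
    linarith


theorem side_omega {q : ℝ} (w : ℕ → ℝ) (h1 : ∀ n, 1 ≤ w n) (h2 : ∀ m n, w (m + n) ≤ w m * w n)
    (h3 : Summable fun n => w n ^ (-q))
    (h4 : ∀ n, ∑ k ∈ Finset.range (n + 1), w k ^ (-q) * w (n - k) ^ (-q) ≤ w n ^ (-q))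
    (h5 : ∃ K > (0 : ℝ), ∀ n k, 1 ≤ n → 1 ≤ k → w n ≤ K * w (n + k))
    (h6 : ∀ r : ℝ, 1 < r → ∀ C : ℝ, ∃ n : ℕ, C * w n < r ^ n) :
    ∃ K, HG q (fun n => if n = 0 then 1 else w n) K := by
  obtain ⟨K, hK, h5⟩ := h5
  have hp : ∀ n, 0 < w n := fun n => lt_of_lt_of_le one_pos (h1 n)
  have hone : ∀ n, (1 : ℝ) ≤ (if n = 0 then 1 else w n) := by
    intro n
    split_ifs
    · exact le_rfl
    · exact h1 n
  have hpu : ∀ n, (0 : ℝ) < (if n = 0 then 1 else w n) := fun n => lt_of_lt_of_le one_pos (hone n)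
  refine ⟨K + 3, ?_, hone, ?_, ?_, ?_, ?_, ?_⟩
  · simp
  · intro m n
    have key : (if m + n = 0 then 1 else w (m + n)) ≤ (if m = 0 then 1 else w m) * (if n = 0 then 1 else w n) := by
      rcases Nat.eq_zero_or_pos m with rfl | hm
      · simp
      rcases Nat.eq_zero_or_pos n with rfl | hn
      · simp
      rw [if_neg (by omega), if_neg (by omega), if_neg (by omega)]
      exact h2 m n
    have hnn := mul_pos (hpu m) (hpu n)
    beta_reduce
    nlinarith
  · intro n k
    beta_reduce
    have h1' := hone (n + k)
    rcases Nat.eq_zero_or_pos n with rfl | hn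
    · rw [if_pos rfl]
      nlinarith
    rcases Nat.eq_zero_or_pos k with rfl | hk
    · rw [add_zero] at h1' ⊢
      nlinarith
    rw [if_neg (by omega), if_neg (by omega)]
    have := h5 n k hn hk
    have := hp (n + k)
    nlinarith
  · refine (summable_congr_cofinite ?_).1 h3
    rw [Filter.EventuallyEq, Filter.eventually_cofinite]
    refine Set.Finite.subset (Set.finite_singleton 0) ?_
    intro n hn
    by_contra h
    apply hn
    have : n ≠ 0 := h
    simp only [if_neg this]
  · intro n
    beta_reduce
    set u : ℕ → ℝ := fun n => if n = 0 then 1 else w n with hu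
    change ∑ k ∈ Finset.range (n + 1), u k ^ (-q) * u (n - k) ^ (-q) ≤ (K + 3) * u n ^ (-q)
    have hu0 : u 0 = 1 := rfl
    have hun : ∀ n, n ≠ 0 → u n = w n := fun n hn => if_neg hn
    have hN : 0 ≤ u n ^ (-q) := Real.rpow_nonneg (hpu n).le _
    rcases Nat.eq_zero_or_pos n with rfl | hn
    · simp [hu0]
      linarith
    have hb : ∀ k ∈ Finset.range (n + 1), u k ^ (-q) * u (n - k) ^ (-q)
        ≤ w k ^ (-q) * w (n - k) ^ (-q) + ((if k = 0 then u n ^ (-q) else 0) + (if k = n then u n ^ (-q) else 0)) := by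
      intro k hk
      have hk' : k ≤ n := by rw [Finset.mem_range] at hk; omega
      have hw := mul_nonneg (Real.rpow_nonneg (hp k).le (-q)) (Real.rpow_nonneg (hp (n - k)).le (-q))
      by_cases hk0 : k = 0
      · subst hk0
        rw [hu0, Real.one_rpow, one_mul, Nat.sub_zero, if_pos rfl] at *
        have : 0 ≤ (if 0 = n then u n ^ (-q) else 0) := by split_ifs <;> simp [hN]
        linarith
      by_cases hkn : k = n
      · subst hkn
        rw [Nat.sub_self, hu0, Real.one_rpow, mul_one, if_neg hk0, if_pos rfl]
        rw [Nat.sub_self] at hw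
        linarith
      · rw [if_neg hk0, if_neg hkn, hun k hk0, hun (n - k) (by omega)]
        linarith
    refine (Finset.sum_le_sum hb).trans ?_
    rw [Finset.sum_add_distrib, Finset.sum_add_distrib, Finset.sum_ite_eq' , Finset.sum_ite_eq',
      if_pos (by simp), if_pos (by simp)]
    have := h4 n
    rw [← hun n hn.ne'] at this
    have := mul_nonneg hK.le hN
    linarith
  · intro r hr C
    obtain ⟨n, hn⟩ := h6 r hr (max C 1)
    refine ⟨n, lt_of_le_of_lt ?_ hn⟩
    have hle : (if n = 0 then 1 else w n) ≤ w n := by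
      split_ifs
      · exact h1 n
      · exact le_rfl
    calc _ ≤ max C 1 * (if n = 0 then 1 else w n) :=
          mul_le_mul_of_nonneg_right (le_max_left _ _) (hpu n).le
      _ ≤ _ := mul_le_mul_of_nonneg_left hle (le_trans zero_le_one (le_max_right _ _))

theorem poly_tendsto (r : ℝ) (hr : 1 < r) :
    Filter.Tendsto (fun n : ℕ => ((n : ℝ) + 1) ^ 2 / r ^ n) Filter.atTop (nhds 0) := by
  have h := (tendsto_pow_const_div_const_pow_of_one_lt 2 hr).comp (Filter.tendsto_add_atTop_nat 1)
  have h2 := h.const_mul r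
  rw [mul_zero] at h2
  refine h2.congr fun n => ?_
  have : r ≠ 0 := by positivity
  simp only [Function.comp]
  push_cast
  field_simp
  ring

theorem side_poly {q : ℝ} (hq : 1 < q) : ∃ K, HG q (fun n => ((n : ℝ) + 1) ^ 2) K := by
  have hone : ∀ n : ℕ, (1 : ℝ) ≤ ((n : ℝ) + 1) ^ 2 := fun n => by
    have : (0 : ℝ) ≤ n := n.cast_nonneg
    nlinarith
  have hp : ∀ n : ℕ, (0 : ℝ) < ((n : ℝ) + 1) ^ 2 := fun n => lt_of_lt_of_le one_pos (hone n)
  have hs : Summable fun n : ℕ => (((n : ℝ) + 1) ^ 2) ^ (-q) := by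
    have h1 : Summable fun n : ℕ => (((n + 1 : ℕ) : ℝ)) ^ (-(2 * q)) :=
      (summable_nat_add_iff 1).2 (Real.summable_nat_rpow.2 (by linarith))
    refine h1.congr fun n => ?_
    rw [← Real.rpow_natCast, ← Real.rpow_mul (by positivity)]
    push_cast
    congr 1
    ring
  set a : ℕ → ℝ := fun n : ℕ => (((n : ℝ) + 1) ^ 2) ^ (-q) with ha
  have ha0 : ∀ n, 0 ≤ a n := fun n => Real.rpow_nonneg (hp n).le _
  have hS0 : 0 ≤ ∑' n, a n := tsum_nonneg ha0
  have h4 : (0 : ℝ) ≤ 4 ^ q := by positivity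
  have hK : 1 ≤ 4 ^ q * (2 * ∑' n, a n) + 1 := by
    have := mul_nonneg h4 hS0
    linarith
  refine ⟨4 ^ q * (2 * ∑' n, a n) + 1, by simp, hone, ?_, ?_, hs, ?_, ?_⟩
  · intro m n
    have hm : (0 : ℝ) ≤ m := m.cast_nonneg
    have hn : (0 : ℝ) ≤ n := n.cast_nonneg
    have hmn := mul_nonneg hm hn
    have key : ((m + n : ℕ) + 1 : ℝ) ^ 2 ≤ ((m : ℝ) + 1) ^ 2 * ((n : ℝ) + 1) ^ 2 := by
      rw [← mul_pow]
      push_cast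
      apply pow_le_pow_left₀ (by positivity)
      linarith
    exact key.trans (le_mul_of_one_le_left (mul_pos (hp m) (hp n)).le hK)
  · intro n k
    have hk : (0 : ℝ) ≤ k := k.cast_nonneg
    have hn : (0 : ℝ) ≤ n := n.cast_nonneg
    have key : (n + 1 : ℝ) ^ 2 ≤ ((n + k : ℕ) + 1 : ℝ) ^ 2 := by
      push_cast
      apply pow_le_pow_left₀ (by positivity)
      linarith
    exact key.trans (le_mul_of_one_le_left (hp _).le hK)
  · intro n
    change ∑ k ∈ Finset.range (n + 1), a k * a (n - k) ≤ (4 ^ q * (2 * ∑' n, a n) + 1) * a n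
    have hhalf : ∀ j : ℕ, n ≤ 2 * j → a j ≤ 4 ^ q * a n := by
      intro j hj
      apply rpow_neg_le (by linarith) (hp _) (hp _) (by norm_num)
      have hj' : (n : ℝ) ≤ 2 * j := by exact_mod_cast hj
      have hn : (0 : ℝ) ≤ n := n.cast_nonneg
      calc ((n : ℝ) + 1) ^ 2 ≤ (2 * ((j : ℝ) + 1)) ^ 2 := by
            apply pow_le_pow_left₀ (by positivity)
            linarith
        _ = _ := by ring
    have hb : ∀ k ∈ Finset.range (n + 1), a k * a (n - k) ≤ 4 ^ q * a n * (a k + a (n - k)) := by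
      intro k hk
      have hk' : k ≤ n := by rw [Finset.mem_range] at hk; omega
      have hc := mul_nonneg h4 (ha0 n)
      have c1 := mul_nonneg hc (ha0 k)
      have c2 := mul_nonneg hc (ha0 (n - k))
      by_cases hkn : n ≤ 2 * k
      · have := mul_le_mul_of_nonneg_right (hhalf k hkn) (ha0 (n - k))
        linarith
      · have := mul_le_mul_of_nonneg_left (hhalf (n - k) (by omega)) (ha0 k)
        linarith
    refine (Finset.sum_le_sum hb).trans ?_
    rw [← Finset.mul_sum, Finset.sum_add_distrib]
    have e1 : ∑ k ∈ Finset.range (n + 1), a (n - k) = ∑ k ∈ Finset.range (n + 1), a k := by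
      have := Finset.sum_range_reflect a (n + 1)
      rw [← this]
      apply Finset.sum_congr rfl
      intro k _
      congr 1
    have e2 : ∑ k ∈ Finset.range (n + 1), a k ≤ ∑' k, a k := hs.sum_le_tsum _ (fun k _ => ha0 k)
    rw [e1]
    have := mul_le_mul_of_nonneg_left e2 (mul_nonneg h4 (ha0 n))
    have := ha0 n
    linarith
  · intro r hr C
    have h := (poly_tendsto r hr).const_mul C
    rw [mul_zero] at h
    obtain ⟨n, hn⟩ := (h.eventually (gt_mem_nhds one_pos)).exists
    refine ⟨n, ?_⟩
    have hrn : 0 < r ^ n := by positivity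
    rw [← mul_div_assoc, div_lt_one hrn] at hn
    exact hn

theorem growth_of {w : ℕ → ℝ} (h1 : ∀ n, 1 ≤ w n) (h2 : ∀ m n, w (m + n) ≤ w m * w n)
    (h : ∀ r : ℝ, 1 < r → ∃ m, 0 < m ∧ w m < r ^ m) :
    ∀ r : ℝ, 1 < r → ∀ C : ℝ, ∃ n : ℕ, C * w n < r ^ n := by
  intro r hr C
  obtain ⟨m, hm, hwm⟩ := h r hr
  have hp : ∀ n, 0 < w n := fun n => lt_of_lt_of_le one_pos (h1 n)
  have hrm : 0 < r ^ m := by positivity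
  have hpow : ∀ j : ℕ, w (m * j) ≤ w 0 * w m ^ j := by
    intro j
    induction j with
    | zero => simp
    | succ j ih =>
      calc w (m * (j + 1)) ≤ w (m * j) * w m := by rw [mul_add, mul_one]; exact h2 _ _
        _ ≤ w 0 * w m ^ j * w m := mul_le_mul_of_nonneg_right ih (hp m).le
        _ = _ := by ring
  have ht := (tendsto_pow_atTop_nhds_zero_of_lt_one (r := w m / r ^ m) (div_pos (hp m) hrm).le
    ((div_lt_one hrm).2 hwm)).const_mul (|C| * w 0)
  rw [mul_zero] at ht
  obtain ⟨j, hj⟩ := (ht.eventually (gt_mem_nhds one_pos)).exists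
  refine ⟨m * j, ?_⟩
  have hrj : 0 < (r ^ m) ^ j := by positivity
  rw [div_pow, ← mul_div_assoc, div_lt_one hrj] at hj
  rw [pow_mul]
  calc C * w (m * j) ≤ |C| * w (m * j) := mul_le_mul_of_nonneg_right (le_abs_self C) (hp _).le
    _ ≤ |C| * (w 0 * w m ^ j) := mul_le_mul_of_nonneg_left (hpow j) (abs_nonneg C)
    _ < _ := by rw [← mul_assoc]; exact hj

theorem side {q : ℝ} (hq : 1 < q) (P : Prop) (w : ℕ → ℝ) (h1 : ∀ n, 1 ≤ w n)
    (h2 : ∀ m n, w (m + n) ≤ w m * w n)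
    (h3 : Summable fun n => w n ^ (-q))
    (h4 : ∀ n, ∑ k ∈ Finset.range (n + 1), w k ^ (-q) * w (n - k) ^ (-q) ≤ w n ^ (-q))
    (h5 : P → ∃ K > (0 : ℝ), ∀ n k, 1 ≤ n → 1 ≤ k → w n ≤ K * w (n + k))
    (h6 : P → ∀ r : ℝ, 1 < r → ∃ m, 0 < m ∧ w m < r ^ m)
    (h7 : ¬ P → ∃ r : ℝ, 1 < r ∧ ∀ n : ℕ, 0 < n → r ^ n ≤ w n) :
    ∃ (u : ℕ → ℝ) (K : ℝ), HG q u K ∧ (∃ M > (0 : ℝ), ∀ n, u n ≤ M * w n) ∧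
      (P → ∃ M > (0 : ℝ), ∀ n, w n ≤ M * u n) := by
  by_cases hP : P
  · obtain ⟨K, hK⟩ := side_omega w h1 h2 h3 h4 (h5 hP) (growth_of h1 h2 (h6 hP))
    refine ⟨_, K, hK, ⟨1, one_pos, fun n => ?_⟩, fun _ => ⟨w 0, ?_, fun n => ?_⟩⟩
    · rw [one_mul]
      beta_reduce
      split_ifs
      · exact h1 n
      · exact le_rfl
    · exact lt_of_lt_of_le one_pos (h1 0)
    · beta_reduce
      split_ifs with hn
      · rw [hn, mul_one]
      · have := h1 0
        have := h1 n
        nlinarith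
  · obtain ⟨K, hK⟩ := side_poly hq
    obtain ⟨r, hr, hw⟩ := h7 hP
    refine ⟨_, K, hK, ?_, fun h => absurd h hP⟩
    obtain ⟨M, hM⟩ := (poly_tendsto r hr).bddAbove_range
    refine ⟨max M 1, lt_of_lt_of_le one_pos (le_max_right _ _), fun n => ?_⟩
    rcases Nat.eq_zero_or_pos n with rfl | hn
    · have := h1 0
      have := le_max_right M 1
      simp
      nlinarith
    · have h8 : ((n : ℝ) + 1) ^ 2 / r ^ n ≤ M := hM ⟨n, rfl⟩
      have hrn : 0 < r ^ n := by positivity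
      rw [div_le_iff₀ hrn] at h8
      calc _ ≤ M * r ^ n := h8
        _ ≤ max M 1 * r ^ n := mul_le_mul_of_nonneg_right (le_max_left _ _) hrn.le
        _ ≤ _ := mul_le_mul_of_nonneg_left (hw n hn) (le_trans zero_le_one (le_max_right _ _))


theorem root_pow {x : ℝ} (hx : 0 ≤ x) {n : ℕ} (hn : 0 < n) : (x ^ ((1 : ℝ) / (n : ℝ))) ^ n = x := by
  rw [one_div]
  exact Real.rpow_inv_natCast_pow hx hn.ne'

theorem amaw_sums {q : ℝ} {ω : ℤ → ℝ} (h : IsAMAW q ω) (φ : ℕ → ℤ) (hφ : Function.Injective φ)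
    (hsub : ∀ n k, k ≤ n → φ n - φ k = φ (n - k)) :
    (Summable fun n => ω (φ n) ^ (-q)) ∧
    ∀ n, ∑ k ∈ Finset.range (n + 1), ω (φ k) ^ (-q) * ω (φ (n - k)) ^ (-q) ≤ ω (φ n) ^ (-q) := by
  obtain ⟨hw, hc, hs, -, -⟩ := h
  refine ⟨hs.comp_injective hφ, fun n => ?_⟩
  have hpos : ∀ n, 0 ≤ ω n ^ (-q) := fun n =>
    Real.rpow_nonneg (zero_le_one.trans (hw.1 n)) _
  refine le_trans ?_ (hc (φ n))
  have hsum := (conv_sum (fun n => ω n ^ (-q)) (fun n => ω n ^ (-q)) hs.norm hs.norm).1 (φ n)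
  have := (hsum.comp_injective hφ).sum_le_tsum (Finset.range (n + 1))
    (fun k _ => mul_nonneg (hpos _) (hpos _))
  have h2 : ∑' k, ((fun k => ω k ^ (-q) * ω (φ n - k) ^ (-q)) ∘ φ) k
      ≤ ∑' k, ω k ^ (-q) * ω (φ n - k) ^ (-q) :=
    tsum_comp_le_tsum_of_inj hsum (fun k => mul_nonneg (hpos _) (hpos _)) hφ
  refine le_trans (le_of_eq ?_) (this.trans h2)
  refine Finset.sum_congr rfl fun k hk => ?_
  have hk' : k ≤ n := by have := Finset.mem_range.1 hk; omega
  simp only [Function.comp, hsub n k hk']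

theorem rho2_spec {ω : ℤ → ℝ} (h1 : ∀ n, 1 ≤ ω n) :
    (rho2 ω = 1 → ∀ r : ℝ, 1 < r → ∃ m : ℕ, 0 < m ∧ ω (m : ℤ) < r ^ m) ∧
    (¬ rho2 ω = 1 → ∃ r : ℝ, 1 < r ∧ ∀ n : ℕ, 0 < n → r ^ n ≤ ω (n : ℤ)) := by
  have hp : ∀ n, 0 ≤ ω n := fun n => zero_le_one.trans (h1 n)
  have hne : {x : ℝ | ∃ n : ℕ, 0 < n ∧ x = ω (n : ℤ) ^ ((1 : ℝ) / (n : ℝ))}.Nonempty :=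
    ⟨_, 1, one_pos, rfl⟩
  have hlb : ∀ x ∈ {x : ℝ | ∃ n : ℕ, 0 < n ∧ x = ω (n : ℤ) ^ ((1 : ℝ) / (n : ℝ))}, 1 ≤ x := by
    rintro x ⟨n, hn, rfl⟩
    exact Real.one_le_rpow (h1 _) (by positivity)
  constructor
  · intro h r hr
    rw [rho2] at h
    rw [← h] at hr
    obtain ⟨x, ⟨n, hn, rfl⟩, hx⟩ := exists_lt_of_csInf_lt hne hr
    refine ⟨n, hn, ?_⟩
    rw [← root_pow (hp n) hn]
    exact pow_lt_pow_left₀ hx (Real.rpow_nonneg (hp _) _) hn.ne'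
  · intro h
    have hge : 1 ≤ rho2 ω := le_csInf hne hlb
    refine ⟨rho2 ω, lt_of_le_of_ne hge (Ne.symm h), fun n hn => ?_⟩
    rw [← root_pow (hp n) hn]
    refine pow_le_pow_left₀ (zero_le_one.trans hge) ?_ n
    exact csInf_le ⟨1, hlb⟩ ⟨n, hn, rfl⟩

theorem rho1_spec {ω : ℤ → ℝ} (h1 : ∀ n, 1 ≤ ω n) :
    (rho1 ω = 1 → ∀ r : ℝ, 1 < r → ∃ m : ℕ, 0 < m ∧ ω (-(m : ℤ)) < r ^ m) ∧
    (¬ rho1 ω = 1 → ∃ r : ℝ, 1 < r ∧ ∀ n : ℕ, 0 < n → r ^ n ≤ ω (-(n : ℤ))) := by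
  have hp : ∀ n, 0 ≤ ω n := fun n => zero_le_one.trans (h1 n)
  have hinv : ∀ n : ℕ, ω (-(n : ℤ)) ^ (-(1 : ℝ) / (n : ℝ)) = (ω (-(n : ℤ)) ^ ((1 : ℝ) / (n : ℝ)))⁻¹ := by
    intro n
    rw [neg_div, Real.rpow_neg (hp _)]
  have hone : ∀ n : ℕ, 1 ≤ ω (-(n : ℤ)) ^ ((1 : ℝ) / (n : ℝ)) := fun n =>
    Real.one_le_rpow (h1 _) (by positivity)
  have hne : {x : ℝ | ∃ n : ℕ, 0 < n ∧ x = ω (-(n : ℤ)) ^ (-(1 : ℝ) / (n : ℝ))}.Nonempty :=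
    ⟨_, 1, one_pos, rfl⟩
  have hub : ∀ x ∈ {x : ℝ | ∃ n : ℕ, 0 < n ∧ x = ω (-(n : ℤ)) ^ (-(1 : ℝ) / (n : ℝ))}, x ≤ 1 := by
    rintro x ⟨n, hn, rfl⟩
    rw [hinv]
    exact inv_le_one_of_one_le₀ (hone n)
  constructor
  · intro h r hr
    rw [rho1] at h
    have hr' : r⁻¹ < 1 := inv_lt_one_of_one_lt₀ hr
    rw [← h] at hr'
    obtain ⟨x, ⟨n, hn, rfl⟩, hx⟩ := exists_lt_of_lt_csSup hne hr'
    refine ⟨n, hn, ?_⟩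
    rw [hinv, inv_lt_inv₀ (by linarith) (by linarith [hone n])] at hx
    rw [← root_pow (hp (-(n : ℤ))) hn]
    exact pow_lt_pow_left₀ hx (Real.rpow_nonneg (hp _) _) hn.ne'
  · intro h
    have hle : rho1 ω ≤ 1 := csSup_le hne hub
    have hmem : ∀ n : ℕ, 0 < n → (ω (-(n : ℤ)) ^ ((1 : ℝ) / (n : ℝ)))⁻¹ ≤ rho1 ω := fun n hn =>
      le_csSup ⟨1, hub⟩ ⟨n, hn, (hinv n).symm⟩
    have hpos : 0 < rho1 ω := by
      refine lt_of_lt_of_le ?_ (hmem 1 one_pos)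
      have := hone 1
      exact inv_pos.2 (by linarith)
    refine ⟨(rho1 ω)⁻¹, (one_lt_inv₀ hpos).2 (lt_of_le_of_ne hle h), fun n hn => ?_⟩
    rw [← root_pow (hp (-(n : ℤ))) hn]
    refine pow_le_pow_left₀ (inv_pos.2 hpos).le ?_ n
    exact inv_le_of_inv_le₀ (by linarith [hone n]) (hmem n hn)

theorem pacfs_mono {A : Type*} [NormedRing A] [NormedAlgebra ℂ A] [CompleteSpace A]
    {p K : ℝ} {ω ν : ℤ → ℝ} (hp : 0 ≤ p) (hK : 0 ≤ K) (hν : ∀ n, 0 ≤ ν n) (hω : ∀ n, 0 ≤ ω n)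
    (h : ∀ n, ν n ≤ K * ω n) (f : ℂ → A) (hf : HasPACFS p ω f) : HasPACFS p ν f := by
  refine ⟨hf.1, Summable.of_nonneg_of_le (fun n => ?_) (fun n => ?_) (hf.2.mul_left (K ^ p))⟩
  · exact mul_nonneg (Real.rpow_nonneg (norm_nonneg _) _) (Real.rpow_nonneg (hν n) _)
  · have := Real.rpow_le_rpow (hν n) (h n) hp
    rw [Real.mul_rpow hK (hω n)] at this
    calc _ ≤ ‖fourierCoef f n‖ ^ p * (K ^ p * ω n ^ p) :=
          mul_le_mul_of_nonneg_left this (Real.rpow_nonneg (norm_nonneg _) _)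
      _ = _ := by ring


theorem stmt1 {A : Type*} [NormedRing A] [NormedAlgebra ℂ A] [CompleteSpace A] [NormOneClass A]
    (p q : ℝ) (hp : 1 < p) (hpq : 1 / p + 1 / q = 1)
    (ω : ℤ → ℝ) (hω : IsAMAW q ω)
    (f : ℂ → A) (hfc : ContinuousOn f {z : ℂ | ‖z‖ = 1})
    (hf : HasPACFS p ω f)
    (hinv : ∀ z : ℂ, ‖z‖ = 1 → ∃ u : A, u * f z = 1) :
    (∃ (ν : ℤ → ℝ) (g : ℂ → A), IsAMAW q ν ∧
        (∃ K > (0 : ℝ), ∀ n, 1 ≤ ν n ∧ ν n ≤ K * ω n) ∧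
        ContinuousOn g {z : ℂ | ‖z‖ = 1} ∧ HasPACFS p ν g ∧
        ∀ z : ℂ, ‖z‖ = 1 → g z * f z = 1) ∧
      (IsAdmissible ω → ∃ g : ℂ → A,
        ContinuousOn g {z : ℂ | ‖z‖ = 1} ∧ HasPACFS p ω g ∧
        ∀ z : ℂ, ‖z‖ = 1 → g z * f z = 1) := by
  have hpq' : p.HolderConjugate q := by
    rw [Real.holderConjugate_iff]
    exact ⟨hp, by simpa [one_div] using hpq⟩
  have hq : 1 < q := hpq'.symm.lt
  have h1 := hω.1.1
  have hω0 : ∀ n, 0 ≤ ω n := fun n => zero_le_one.trans (h1 n)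
  obtain ⟨s1, s2⟩ := amaw_sums hω (fun n => (n : ℤ)) Nat.cast_injective
    (fun n k hk => by push_cast [Nat.cast_sub hk]; rfl)
  obtain ⟨t1, t2⟩ := amaw_sums hω (fun n => -(n : ℤ))
    (fun a b hab => by simpa using hab)
    (fun n k hk => by push_cast [Nat.cast_sub hk]; ring)
  obtain ⟨u, K1, hu, ⟨M1, hM1, hu1⟩, hu2⟩ := side hq (rho2 ω = 1) (fun n => ω (n : ℤ))
    (fun n => h1 _) (fun m n => by push_cast; exact hω.1.2 _ _) s1 s2
    (fun hP => by
      obtain ⟨K, hK, h⟩ := hω.2.2.2.2 hP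
      exact ⟨K, hK, fun n k _ _ => by push_cast; exact h _ _ (by omega) (by omega)⟩)
    (rho2_spec h1).1 (rho2_spec h1).2
  obtain ⟨v, K2, hv, ⟨M2, hM2, hv1⟩, hv2⟩ := side hq (rho1 ω = 1) (fun n => ω (-(n : ℤ)))
    (fun n => h1 _) (fun m n => by push_cast; rw [neg_add]; exact hω.1.2 _ _) t1 t2
    (fun hP => by
      obtain ⟨K, hK, h⟩ := hω.2.2.2.1 hP
      exact ⟨K, hK, fun n k _ _ => by push_cast; rw [neg_add]; exact h _ _ (by omega) (by omega)⟩)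
    (rho1_spec h1).1 (rho1_spec h1).2
  have hu' := hu.mono_K (le_max_left K1 K2)
  have hv' := hv.mono_K (le_max_right K1 K2)
  have h0 : u 0 = v 0 := by rw [hu.zero, hv.zero]
  obtain ⟨c, hc, hν⟩ := glue_final hpq' hu' hv'
  have hc0 : 0 < c := by linarith
  have hW : WGood p q (fun n => c * glue u v n) := ⟨hpq', hν.1.1, hν.2.1, hν.2.2.1⟩
  have hν0 : ∀ n, 0 ≤ c * glue u v n := fun n => zero_le_one.trans (hν.1.1 n)
  have hle : ∀ n, c * glue u v n ≤ (c * (M1 + M2)) * ω n := by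
    intro n
    rw [mul_assoc]
    refine mul_le_mul_of_nonneg_left ?_ hc0.le
    obtain ⟨m, rfl | rfl⟩ := n.eq_nat_or_neg
    · rw [glue_nat]
      have := hu1 m
      have := mul_nonneg hM2.le (hω0 m)
      linarith
    · rw [glue_neg u v h0]
      have := hv1 m
      have := mul_nonneg hM1.le (hω0 (-(m : ℤ)))
      linarith
  have hKpos : 0 < c * (M1 + M2) := by positivity
  have hp0 : 0 ≤ p := by linarith
  obtain ⟨g, hg1, hg2, hg3⟩ := main_aux hW
    (fun r hr C => by
      obtain ⟨n, hn⟩ := hu.growth r hr (C * c)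
      exact ⟨n, by rw [glue_nat, ← mul_assoc]; exact hn⟩)
    (fun r hr C => by
      obtain ⟨n, hn⟩ := hv.growth r hr (C * c)
      exact ⟨n, by rw [glue_neg u v h0, ← mul_assoc]; exact hn⟩)
    f (pacfs_mono hp0 hKpos.le hν0 hω0 hle f hf) hinv
  refine ⟨⟨_, g, hν, ⟨_, hKpos, fun n => ⟨hν.1.1 n, hle n⟩⟩, hg1, hg2, hg3⟩, fun hadm => ?_⟩
  obtain ⟨N1, hN1, hu3⟩ := hu2 hadm.2
  obtain ⟨N2, hN2, hv3⟩ := hv2 hadm.1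
  refine ⟨g, hg1, pacfs_mono (K := N1 + N2) hp0 (by positivity) hω0 hν0 (fun n => ?_) g hg2, hg3⟩
  have hg0 := glue_one_le hu' hv' n
  have hcg : (N1 + N2) * glue u v n ≤ (N1 + N2) * (c * glue u v n) :=
    mul_le_mul_of_nonneg_left (by nlinarith) (by positivity)
  refine le_trans ?_ hcg
  obtain ⟨m, rfl | rfl⟩ := n.eq_nat_or_neg
  · rw [glue_nat] at hg0 ⊢
    have := hu3 m
    nlinarith
  · rw [glue_neg u v h0] at hg0 ⊢
    have := hv3 m
    nlinarith
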